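/- arXiv:2112.09869 — 2 statements merged into one kernel-verified Lean document; each statement's English description precedes it below -/
import Mathlib

section
/- An element b of the even Clifford algebra A of the quadratic form diag(1,1,0) on ℂ³ satisfies b² = b if and only if b = 0, or b = 1, or there exist a₂, a₃ ∈ ℂ such that b = (1/2)·(1 + x) + a₂·y + a₃·z or b = (1/2)·(1 − x) + a₂·y + a₃·z. -/
open CliffordAlgebra

noncomputable section

/-- The quadratic form `v ↦ v₀² + v₁²` on `ℂ³`, with Gram matrix `diag(1,1,0)` —
the quadratic form of a corank-1 degenerate conic. -/
def Q : QuadraticForm ℂ (Fin 3 → ℂ) := QuadraticMap.weightedSumSquares ℂ ![1, 1, 0]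

/-- The standard basis vectors `e₁, e₂, e₃` of `ℂ³` (indexed by `0, 1, 2`). -/
def e (j : Fin 3) : Fin 3 → ℂ := Pi.single j 1

/-- `x = i·ι(e₁)·ι(e₂)` in the Clifford algebra of `Q`. -/
def x : CliffordAlgebra Q := Complex.I • (ι Q (e 0) * ι Q (e 1))

/-- `y = i·ι(e₂)·ι(e₃)` in the Clifford algebra of `Q`. -/
def y : CliffordAlgebra Q := Complex.I • (ι Q (e 1) * ι Q (e 2))

/-- `z = ι(e₁)·ι(e₃)` in the Clifford algebra of `Q`. -/
def z : CliffordAlgebra Q := ι Q (e 0) * ι Q (e 2)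

lemma x_mem : x ∈ even Q := Subalgebra.smul_mem _ (ι_mul_ι_mem_evenOdd_zero Q _ _) _

lemma y_mem : y ∈ even Q := Subalgebra.smul_mem _ (ι_mul_ι_mem_evenOdd_zero Q _ _) _

lemma z_mem : z ∈ even Q := ι_mul_ι_mem_evenOdd_zero Q _ _

/-- `x` as an element of the even Clifford algebra `A = CliffordAlgebra.even Q`. -/
def xA : even Q := ⟨x, x_mem⟩

/-- `y` as an element of the even Clifford algebra `A = CliffordAlgebra.even Q`. -/
def yA : even Q := ⟨y, y_mem⟩

/-- `z` as an element of the even Clifford algebra `A = CliffordAlgebra.even Q`. -/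
def zA : even Q := ⟨z, z_mem⟩

lemma Q_apply (m : Fin 3 → ℂ) : Q m = m 0 * m 0 + m 1 * m 1 := by
  simp [Q, QuadraticMap.weightedSumSquares_apply, Fin.sum_univ_three]

lemma ι_e_zero_sq : ι Q (e 0) * ι Q (e 0) = 1 := by
  simp [ι_sq_scalar, Q_apply, e]

lemma ι_e_one_sq : ι Q (e 1) * ι Q (e 1) = 1 := by
  simp [ι_sq_scalar, Q_apply, e]

lemma ι_e_two_sq : ι Q (e 2) * ι Q (e 2) = 0 := by
  simp [ι_sq_scalar, Q_apply, e]

lemma ι_e_one_mul_zero : ι Q (e 1) * ι Q (e 0) = -(ι Q (e 0) * ι Q (e 1)) := by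
  rw [eq_neg_iff_add_eq_zero, ι_mul_ι_add_swap]
  simp [QuadraticMap.polar, Q_apply, e]

lemma ι_e_two_mul_zero : ι Q (e 2) * ι Q (e 0) = -(ι Q (e 0) * ι Q (e 2)) := by
  rw [eq_neg_iff_add_eq_zero, ι_mul_ι_add_swap]
  simp [QuadraticMap.polar, Q_apply, e]

lemma ι_e_two_mul_one : ι Q (e 2) * ι Q (e 1) = -(ι Q (e 1) * ι Q (e 2)) := by
  rw [eq_neg_iff_add_eq_zero, ι_mul_ι_add_swap]
  simp [QuadraticMap.polar, Q_apply, e]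

/-- The multiplication rules of three pairwise anticommuting elements with squares `1, 1, 0`,
for the products `i·a·b`, `i·b·c` and `a·c`. -/
lemma anticommuting_products {A : Type*} [Ring A] [Algebra ℂ A] {a b c : A}
    (ha : a * a = 1) (hb : b * b = 1) (hc : c * c = 0)
    (hba : b * a = -(a * b)) (hca : c * a = -(a * c)) (hcb : c * b = -(b * c)) :
    let p := Complex.I • (a * b)
    let q := Complex.I • (b * c)
    let r := a * c
    p * p = 1 ∧ p * q = -r ∧ p * r = -q ∧ q * p = r ∧ q * q = 0 ∧ q * r = 0 ∧
      r * p = q ∧ r * q = 0 ∧ r * r = 0 := by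
  have ha' (t : A) : a * (a * t) = t := by rw [← mul_assoc, ha, one_mul]
  have hb' (t : A) : b * (b * t) = t := by rw [← mul_assoc, hb, one_mul]
  have hba' (t : A) : b * (a * t) = -(a * (b * t)) := by
    rw [← mul_assoc, hba, neg_mul, mul_assoc]
  have hca' (t : A) : c * (a * t) = -(a * (c * t)) := by
    rw [← mul_assoc, hca, neg_mul, mul_assoc]
  have hcb' (t : A) : c * (b * t) = -(b * (c * t)) := by
    rw [← mul_assoc, hcb, neg_mul, mul_assoc]
  refine ⟨?_, ?_, ?_, ?_, ?_, ?_, ?_, ?_, ?_⟩ <;>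
    simp [mul_assoc, smul_smul, ha, hb, hc, hcb, ha', hb', hba', hca', hcb']

/-- The element `k₀ + k₁ x + k₂ y + k₃ z` of the Clifford algebra. -/
def comb (k₀ k₁ k₂ k₃ : ℂ) : CliffordAlgebra Q := k₀ • 1 + k₁ • x + k₂ • y + k₃ • z

lemma comb_mul_comb (k₀ k₁ k₂ k₃ l₀ l₁ l₂ l₃ : ℂ) :
    comb k₀ k₁ k₂ k₃ * comb l₀ l₁ l₂ l₃ =
      comb (k₀ * l₀ + k₁ * l₁) (k₀ * l₁ + k₁ * l₀)
        (k₀ * l₂ + k₂ * l₀ - k₁ * l₃ + k₃ * l₁) (k₀ * l₃ + k₃ * l₀ - k₁ * l₂ + k₂ * l₁) := by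
  obtain ⟨hxx, hxy, hxz, hyx, hyy, hyz, hzx, hzy, hzz⟩ :
      x * x = 1 ∧ x * y = -z ∧ x * z = -y ∧ y * x = z ∧ y * y = 0 ∧ y * z = 0 ∧
        z * x = y ∧ z * y = 0 ∧ z * z = 0 := anticommuting_products
    ι_e_zero_sq ι_e_one_sq ι_e_two_sq ι_e_one_mul_zero ι_e_two_mul_zero ι_e_two_mul_one
  simp only [comb, mul_add, add_mul, smul_mul_smul_comm, one_mul, mul_one, hxx, hxy, hxz, hyx,
    hyy, hyz, hzx, hzy, hzz]
  module

lemma ι_eq_sum (m : Fin 3 → ℂ) :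
    ι Q m = m 0 • ι Q (e 0) + m 1 • ι Q (e 1) + m 2 • ι Q (e 2) := by
  simp only [← map_smul, ← map_add]
  congr 1
  ext j
  fin_cases j <;> simp [e]

lemma ι_mul_ι_eq_comb (m n : Fin 3 → ℂ) :
    ι Q m * ι Q n = comb (m 0 * n 0 + m 1 * n 1) (-Complex.I * (m 0 * n 1 - m 1 * n 0))
      (-Complex.I * (m 1 * n 2 - m 2 * n 1)) (m 0 * n 2 - m 2 * n 0) := by
  have hI (t : ℂ) : -Complex.I * t * Complex.I = t := by
    linear_combination -t * Complex.I_mul_I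
  rw [ι_eq_sum m, ι_eq_sum n]
  simp only [comb, x, y, z, smul_smul, hI, mul_add, add_mul, smul_mul_smul_comm, ι_e_zero_sq,
    ι_e_one_sq, ι_e_two_sq, ι_e_one_mul_zero, ι_e_two_mul_zero, ι_e_two_mul_one]
  module

lemma exists_eq_comb (b : CliffordAlgebra Q) (hb : b ∈ even Q) :
    ∃ k₀ k₁ k₂ k₃ : ℂ, b = comb k₀ k₁ k₂ k₃ := by
  induction b, hb using even_induction with
  | algebraMap r => exact ⟨r, 0, 0, 0, by simp [comb, Algebra.algebraMap_eq_smul_one]⟩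
  | add b c hb hc ihb ihc =>
    obtain ⟨k₀, k₁, k₂, k₃, rfl⟩ := ihb
    obtain ⟨l₀, l₁, l₂, l₃, rfl⟩ := ihc
    exact ⟨k₀ + l₀, k₁ + l₁, k₂ + l₂, k₃ + l₃, by simp only [comb]; module⟩
  | ι_mul_ι_mul m n b hb ih =>
    obtain ⟨k₀, k₁, k₂, k₃, rfl⟩ := ih
    rw [ι_mul_ι_eq_comb, comb_mul_comb]
    exact ⟨_, _, _, _, rfl⟩

/-- The linear map underlying a representation of the Clifford algebra of `Q`, built from
the Pauli matrices, the third one multiplied by a square-zero scalar. -/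
def pauliLinear : (Fin 3 → ℂ) →ₗ[ℂ] Matrix (Fin 4) (Fin 4) ℂ :=
  (LinearMap.proj 0).smulRight !![0, 1, 0, 0; 1, 0, 0, 0; 0, 0, 0, 1; 0, 0, 1, 0] +
  (LinearMap.proj 1).smulRight !![0, -Complex.I, 0, 0; Complex.I, 0, 0, 0;
    0, 0, 0, -Complex.I; 0, 0, Complex.I, 0] +
  (LinearMap.proj 2).smulRight !![0, 0, 1, 0; 0, 0, 0, -1; 0, 0, 0, 0; 0, 0, 0, 0]

lemma pauliLinear_apply (m : Fin 3 → ℂ) :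
    pauliLinear m = !![0, m 0 - m 1 * Complex.I, m 2, 0; m 0 + m 1 * Complex.I, 0, 0, -m 2;
      0, 0, 0, m 0 - m 1 * Complex.I; 0, 0, m 0 + m 1 * Complex.I, 0] := by
  ext i j
  fin_cases i <;> fin_cases j <;> simp [pauliLinear, sub_eq_add_neg]

lemma pauliLinear_sq (m : Fin 3 → ℂ) :
    pauliLinear m * pauliLinear m = algebraMap ℂ _ (Q m) := by
  rw [Q_apply, pauliLinear_apply]
  ext i j
  fin_cases i <;> fin_cases j <;>
    simp [Matrix.mul_apply, Fin.sum_univ_four, Matrix.algebraMap_matrix_apply] <;>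
    first
    | ring1
    | linear_combination -(m 1 * m 1) * Complex.I_mul_I

/-- The representation of the Clifford algebra of `Q` by Pauli matrices. -/
def pauliRep : CliffordAlgebra Q →ₐ[ℂ] Matrix (Fin 4) (Fin 4) ℂ :=
  CliffordAlgebra.lift Q ⟨pauliLinear, pauliLinear_sq⟩

lemma pauliRep_comb (k₀ k₁ k₂ k₃ : ℂ) :
    pauliRep (comb k₀ k₁ k₂ k₃) =
      !![k₀ - k₁, 0, 0, -k₂ - k₃; 0, k₀ + k₁, k₃ - k₂, 0;
        0, 0, k₀ - k₁, 0; 0, 0, 0, k₀ + k₁] := by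
  simp only [comb, x, y, z, map_add, map_smul, map_mul, map_one, pauliRep,
    CliffordAlgebra.lift_ι_apply, pauliLinear_apply]
  ext i j
  fin_cases i <;> fin_cases j <;>
    simp [e] <;> ring

lemma comb_inj {k₀ k₁ k₂ k₃ l₀ l₁ l₂ l₃ : ℂ} :
    comb k₀ k₁ k₂ k₃ = comb l₀ l₁ l₂ l₃ ↔ k₀ = l₀ ∧ k₁ = l₁ ∧ k₂ = l₂ ∧ k₃ = l₃ := by
  refine ⟨fun h ↦ ?_, fun ⟨h₀, h₁, h₂, h₃⟩ ↦ by rw [h₀, h₁, h₂, h₃]⟩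
  have h' := congrArg pauliRep h
  rw [pauliRep_comb, pauliRep_comb] at h'
  have h00 : k₀ - k₁ = l₀ - l₁ := congrFun₂ h' 0 0
  have h11 : k₀ + k₁ = l₀ + l₁ := congrFun₂ h' 1 1
  have h03 : -k₂ - k₃ = -l₂ - l₃ := congrFun₂ h' 0 3
  have h12 : k₃ - k₂ = l₃ - l₂ := congrFun₂ h' 1 2
  refine ⟨?_, ?_, ?_, ?_⟩
  · linear_combination (h00 + h11) / 2
  · linear_combination (h11 - h00) / 2
  · linear_combination -(h03 + h12) / 2
  · linear_combination (h12 - h03) / 2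

lemma comb_isIdempotent_iff {k₀ k₁ k₂ k₃ : ℂ} :
    comb k₀ k₁ k₂ k₃ * comb k₀ k₁ k₂ k₃ = comb k₀ k₁ k₂ k₃ ↔
      (k₀ = 0 ∧ k₁ = 0 ∧ k₂ = 0 ∧ k₃ = 0) ∨ (k₀ = 1 ∧ k₁ = 0 ∧ k₂ = 0 ∧ k₃ = 0) ∨
        (k₀ = 2⁻¹ ∧ (k₁ = 2⁻¹ ∨ k₁ = -2⁻¹)) := by
  rw [comb_mul_comb, comb_inj]
  constructor
  · rintro ⟨h₀, h₁, h₂, h₃⟩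
    by_cases h : 2 * k₀ - 1 = 0
    · have hk₀ : k₀ = 2⁻¹ := by linear_combination h / 2
      have hk₁ : (k₁ - 2⁻¹) * (k₁ + 2⁻¹) = 0 := by
        subst hk₀
        linear_combination h₀
      refine .inr (.inr ⟨hk₀, (mul_eq_zero.mp hk₁).imp ?_ ?_⟩) <;> intro h' <;>
        linear_combination h'
    · have hk₁ : k₁ = 0 := (mul_eq_zero.mp (by linear_combination h₁)).resolve_left h
      have hk₂ : k₂ = 0 := (mul_eq_zero.mp (by linear_combination h₂)).resolve_left h
      have hk₃ : k₃ = 0 := (mul_eq_zero.mp (by linear_combination h₃)).resolve_left h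
      subst hk₁ hk₂ hk₃
      have hk₀ : k₀ * (k₀ - 1) = 0 := by linear_combination h₀
      rcases mul_eq_zero.mp hk₀ with h' | h'
      · simp [h']
      · simp [sub_eq_zero.mp h']
  · rintro (⟨rfl, rfl, rfl, rfl⟩ | ⟨rfl, rfl, rfl, rfl⟩ | ⟨rfl, rfl | rfl⟩) <;>
      refine ⟨?_, ?_, ?_, ?_⟩ <;> ring

/-- An element `b` of the even Clifford algebra `A` of `diag(1,1,0)` on `ℂ³`
satisfies `b² = b` if and only if `b = 0`, or `b = 1`, or there exist `a₂, a₃ ∈ ℂ` such that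
`b = (1/2)·(1 + x) + a₂·y + a₃·z` or `b = (1/2)·(1 − x) + a₂·y + a₃·z`. -/
theorem idempotents_classification (b : even Q) :
    b * b = b ↔
      b = 0 ∨ b = 1 ∨
        ∃ a₂ a₃ : ℂ,
          b = (2 : ℂ)⁻¹ • (1 + xA) + a₂ • yA + a₃ • zA ∨
          b = (2 : ℂ)⁻¹ • (1 - xA) + a₂ • yA + a₃ • zA := by
  obtain ⟨b, hb⟩ := b
  obtain ⟨k₀, k₁, k₂, k₃, rfl⟩ := exists_eq_comb b hb
  have h_zero : (0 : CliffordAlgebra Q) = comb 0 0 0 0 := by simp [comb]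
  have h_one : (1 : CliffordAlgebra Q) = comb 1 0 0 0 := by simp [comb]
  have h_add (a₂ a₃ : ℂ) :
      (2 : ℂ)⁻¹ • (1 + x) + a₂ • y + a₃ • z = comb 2⁻¹ 2⁻¹ a₂ a₃ := by
    simp only [comb, smul_add]
  have h_sub (a₂ a₃ : ℂ) :
      (2 : ℂ)⁻¹ • (1 - x) + a₂ • y + a₃ • z = comb 2⁻¹ (-2⁻¹) a₂ a₃ := by
    simp only [comb, smul_add, smul_neg, neg_smul, sub_eq_add_neg]
  simp only [Subtype.ext_iff, xA, yA, zA, Subalgebra.coe_mul, Subalgebra.coe_add,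
    Subalgebra.coe_sub, Subalgebra.coe_smul, Subalgebra.coe_zero, Subalgebra.coe_one, h_add, h_sub]
  rw [comb_isIdempotent_iff, h_zero, h_one]
  simp only [comb_inj]
  refine or_congr_right (or_congr_right ⟨?_, ?_⟩)
  · rintro ⟨h₀, h₁ | h₁⟩
    · exact ⟨k₂, k₃, .inl ⟨h₀, h₁, rfl, rfl⟩⟩
    · exact ⟨k₂, k₃, .inr ⟨h₀, h₁, rfl, rfl⟩⟩
  · rintro ⟨a₂, a₃, ⟨h₀, h₁, -⟩ | ⟨h₀, h₁, -⟩⟩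
    · exact ⟨h₀, .inl h₁⟩
    · exact ⟨h₀, .inr h₁⟩
end
end

section
/- The even Clifford algebra A of the quadratic form diag(1,1,0) on ℂ³ is not isomorphic as a ℂ-algebra to the matrix algebra M₂(ℂ); i.e. there is no ℂ-algebra isomorphism A ≃ Matrix (Fin 2) (Fin 2) ℂ. -/
open CliffordAlgebra

noncomputable section

/-- The character of `even Q` sending `ι u * ι v` to `(u₀ - i u₁) (v₀ + i v₁)`. -/
def evenCharacter : even Q →ₐ[ℂ] ℂ :=
  even.lift Q
    { bilin := (LinearMap.mul ℂ ℂ).compl₁₂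
        (LinearMap.proj (φ := fun _ : Fin 3 ↦ ℂ) 0 - Complex.I • LinearMap.proj 1)
        (LinearMap.proj (φ := fun _ : Fin 3 ↦ ℂ) 0 + Complex.I • LinearMap.proj 1)
      contract := fun m ↦ by
        simp [Q, QuadraticMap.weightedSumSquares_apply, Fin.sum_univ_three]
        linear_combination (-m 1 ^ 2) * Complex.I_sq
      contract_mid := fun u v w ↦ by
        simp [Q, QuadraticMap.weightedSumSquares_apply, Fin.sum_univ_three]
        linear_combination (-v 1 ^ 2 * (u 0 - Complex.I * u 1) * (w 0 + Complex.I * w 1)) *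
          Complex.I_sq }

/-- A matrix algebra of size two has no homomorphism to a nontrivial commutative ring. -/
theorem isEmpty_matrix_fin_two_ringHom (R S : Type*) [Semiring R] [CommRing S] [Nontrivial S] :
    IsEmpty (Matrix (Fin 2) (Fin 2) R →+* S) := by
  refine ⟨fun f ↦ one_ne_zero (α := S) ?_⟩
  let p : Matrix (Fin 2) (Fin 2) R := !![0, 1; 0, 0]
  let q : Matrix (Fin 2) (Fin 2) R := !![0, 0; 1, 0]
  have hp : p * p = 0 := by ext i j; fin_cases i <;> fin_cases j <;> simp [p]
  have hpq : p * q + q * p = 1 := by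
    ext i j; fin_cases i <;> fin_cases j <;> simp [p, q]
  have hfp : f p * f p = 0 := by rw [← f.map_mul, hp, f.map_zero]
  have h : f p * f q + f q * f p = 1 := by
    rw [← f.map_mul, ← f.map_mul, ← f.map_add, hpq, f.map_one]
  linear_combination -(1 + f p * f q * 2) * h + 4 * f q ^ 2 * hfp

/-- The even Clifford algebra `A` of the degenerate quadratic form
`diag(1,1,0)` on `ℂ³` is not isomorphic as a `ℂ`-algebra to the matrix algebra `M₂(ℂ)`. -/
theorem not_iso_to_matrix_algebra :
    IsEmpty (even Q ≃ₐ[ℂ] Matrix (Fin 2) (Fin 2) ℂ) := by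
  exact ⟨fun φ ↦ (isEmpty_matrix_fin_two_ringHom ℂ ℂ).false
    (evenCharacter.comp φ.symm.toAlgHom).toRingHom⟩
end
end
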